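/- arXiv:1507.05843 — 9 statements merged into one kernel-verified Lean document; each statement's English description precedes it below -/
import Mathlib

section
/- Let φ be an N-function with the good φ' property with constant G. Then the complementary function φ* is twice differentiable on (0,∞), it has the good (φ*)' property with a constant G* depending only on G (i.e. (G*)⁻¹·(φ*)'(t) ≤ t·(φ*)''(t) ≤ G*·(φ*)'(t) for all t > 0), and consequently φ* satisfies the Δ₂ condition with a constant depending only on G (second part of Proposition 1). -/
open MeasureTheory Real Set Filter

noncomputable section

/-- `φ` is an N-function with right-continuous, non-decreasing density `φ'`:
`φ t = ∫₀ᵗ φ'`, `φ'(0) = 0`, `φ' > 0` on `(0,∞)`, `φ'(t) → ∞` as `t → ∞`. -/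
def IsNFunction (φ φ' : ℝ → ℝ) : Prop :=
  (∀ t, 0 ≤ t → φ t = ∫ s in (0:ℝ)..t, φ' s) ∧
  (∀ s, 0 ≤ s → 0 ≤ φ' s) ∧
  (∀ s t, 0 ≤ s → s ≤ t → φ' s ≤ φ' t) ∧
  φ' 0 = 0 ∧
  (∀ t, 0 < t → 0 < φ' t) ∧
  Filter.Tendsto φ' Filter.atTop Filter.atTop ∧
  (∀ t, 0 ≤ t → ContinuousWithinAt φ' (Set.Ici t) t)

/-- The Δ₂ condition with constant `K`: `φ(2t) ≤ K·φ(t)` for all `t ≥ 0`. -/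
def Delta2 (φ : ℝ → ℝ) (K : ℝ) : Prop := ∀ t, 0 ≤ t → φ (2 * t) ≤ K * φ t

/-- The complementary (conjugate) function `φ*(t) = sup_{s ≥ 0} (t·s − φ(s))`. -/
def conjFn (φ : ℝ → ℝ) (t : ℝ) : ℝ := sSup {x | ∃ s, 0 ≤ s ∧ x = t * s - φ s}

/-- The good `φ'` property with constant `G ≥ 1`:
`φ` is `C¹` on `[0,∞)` and `C²` on `(0,∞)` with
`G⁻¹·φ'(t) ≤ t·φ''(t) ≤ G·φ'(t)` for `t > 0`. -/
def GoodPhi (φ φ' φ'' : ℝ → ℝ) (G : ℝ) : Prop :=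
  1 ≤ G ∧
  (∀ t, 0 < t → HasDerivAt φ (φ' t) t) ∧
  (∀ t, 0 < t → HasDerivAt φ' (φ'' t) t) ∧
  ContinuousWithinAt φ' (Set.Ici 0) 0 ∧
  (∀ t, 0 < t → ContinuousAt φ'' t) ∧
  (∀ t, 0 < t → G⁻¹ * φ' t ≤ t * φ'' t ∧ t * φ'' t ≤ G * φ' t)

theorem nf_bounds (φ φ' : ℝ → ℝ) (hN : IsNFunction φ φ') (a b : ℝ) (ha : 0 ≤ a) (hab : a ≤ b) :
    (b - a) * φ' a ≤ φ b - φ a ∧ φ b - φ a ≤ (b - a) * φ' b := by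
  obtain ⟨h1, h2, h3, h4, h5, h6, h7⟩ := hN
  have hint : ∀ x y, 0 ≤ x → x ≤ y → IntervalIntegrable φ' volume x y := by
    intro x y hx hxy
    apply MonotoneOn.intervalIntegrable
    rw [uIcc_of_le hxy]
    intro u hu v hv huv
    exact h3 u v (hx.trans hu.1) huv
  have e : φ b - φ a = ∫ s in a..b, φ' s := by
    rw [h1 b (ha.trans hab), h1 a ha]
    exact intervalIntegral.integral_interval_sub_left (hint 0 b le_rfl (ha.trans hab))
      (hint 0 a le_rfl ha)
  rw [e]
  constructor
  · have := intervalIntegral.integral_mono_on hab (f := fun _ => φ' a) (g := φ') (μ := volume)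
      (by simp) (hint a b ha hab) (fun x hx => h3 a x ha hx.1)
    simpa using this
  · have := intervalIntegral.integral_mono_on hab (f := φ') (g := fun _ => φ' b) (μ := volume)
      (hint a b ha hab) (by simp) (fun x hx => h3 x b (ha.trans hx.1) hx.2)
    simpa using this

theorem nf_young (φ φ' : ℝ → ℝ) (hN : IsNFunction φ φ') (u s : ℝ) (hu : 0 ≤ u) (hs : 0 ≤ s) :
    φ' u * s - φ s ≤ φ' u * u - φ u := by
  rcases le_total u s with h | h
  · have := (nf_bounds φ φ' hN u s hu h).1
    nlinarith
  · have := (nf_bounds φ φ' hN s u hs h).2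
    nlinarith

theorem conj_eq (φ φ' : ℝ → ℝ) (hN : IsNFunction φ φ') (u : ℝ) (hu : 0 ≤ u) :
    conjFn φ (φ' u) = φ' u * u - φ u := by
  apply IsGreatest.csSup_eq
  refine ⟨⟨u, hu, rfl⟩, ?_⟩
  rintro x ⟨s, hs, rfl⟩
  exact nf_young φ φ' hN u s hu hs

theorem phi_bound (φ φ' φ'' : ℝ → ℝ) (G : ℝ) (hN : IsNFunction φ φ') (hG : GoodPhi φ φ' φ'' G)
    (s : ℝ) (hs : 0 < s) : (1 + G) * φ s ≤ G * (s * φ' s) := by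
  obtain ⟨g1, g2, g3, g4, g5, g6⟩ := hG
  have hb := nf_bounds φ φ' hN
  obtain ⟨h1, h2, h3, h4, h5, h6, h7⟩ := hN
  have h0 : φ 0 = 0 := by simpa using h1 0 le_rfl
  have hc0 : ContinuousWithinAt φ (Ici 0) 0 := by
    have hz : Tendsto (fun t => t * φ' t) (nhdsWithin 0 (Ici 0)) (nhds 0) := by
      have : ContinuousWithinAt (fun t => t * φ' t) (Ici 0) 0 := continuousWithinAt_id.mul g4
      simpa [ContinuousWithinAt] using this
    unfold ContinuousWithinAt
    rw [h0]
    refine tendsto_of_tendsto_of_tendsto_of_le_of_le' tendsto_const_nhds hz ?_ ?_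
    · filter_upwards [self_mem_nhdsWithin] with t ht
      have := (hb 0 t le_rfl ht).1
      simp only [h0, h4] at this; linarith
    · filter_upwards [self_mem_nhdsWithin] with t ht
      have := (hb 0 t le_rfl ht).2
      simp only [h0] at this; linarith
  have hc : ∀ {f : ℝ → ℝ} {f' : ℝ → ℝ}, ContinuousWithinAt f (Ici 0) 0 →
      (∀ t, 0 < t → HasDerivAt f (f' t) t) → ContinuousOn f (Ici 0) := by
    intro f f' hf hf' x hx
    rcases eq_or_lt_of_le (show (0:ℝ) ≤ x from hx) with h | h
    · subst h; exact hf
    · exact (hf' x h).continuousAt.continuousWithinAt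
  have hm : MonotoneOn (fun t => G * (t * φ' t) - (1 + G) * φ t) (Ici 0) := by
    apply monotoneOn_of_hasDerivWithinAt_nonneg (convex_Ici 0)
      (f' := fun t => G * (1 * φ' t + t * φ'' t) - (1 + G) * φ' t)
    · exact ((continuousOn_id.mul (hc g4 g3)).const_smul G).sub ((hc hc0 g2).const_smul (1 + G))
    · intro x hx
      rw [interior_Ici] at hx
      exact (((((hasDerivAt_id x).mul (g3 x hx)).const_mul G).sub
        ((g2 x hx).const_mul (1 + G)))).hasDerivWithinAt
    · intro x hx
      rw [interior_Ici] at hx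
      have := (g6 x hx).1
      have hGp : 0 < G := by linarith
      have h8 : φ' x ≤ G * (x * φ'' x) := by
        rwa [inv_mul_le_iff₀ hGp] at this
      show 0 ≤ G * (1 * φ' x + x * φ'' x) - (1 + G) * φ' x
      linarith
  have := hm (mem_Ici.2 le_rfl) (mem_Ici.2 hs.le) hs.le
  simp only [h0, zero_mul, mul_zero, sub_zero] at this
  linarith

theorem exists_inv (φ φ' φ'' : ℝ → ℝ) (G : ℝ) (hN : IsNFunction φ φ') (hG : GoodPhi φ φ' φ'' G) :
    ∃ g : ℝ → ℝ, (∀ t, 0 < t → 0 < g t ∧ φ' (g t) = t) ∧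
      ∀ t, 0 < t → HasDerivAt g (φ'' (g t))⁻¹ t := by
  obtain ⟨g1, g2, g3, g4, g5, g6⟩ := hG
  obtain ⟨h1, h2, h3, h4, h5, h6, h7⟩ := hN
  have hpos : ∀ t, 0 < t → 0 < φ'' t := by
    intro t ht
    have h := (g6 t ht).1
    have : 0 < G⁻¹ * φ' t := mul_pos (inv_pos.2 (by linarith)) (h5 t ht)
    exact pos_of_mul_pos_right (this.trans_le h) ht.le
  have hc : ContinuousOn φ' (Ici 0) := by
    intro x hx
    rcases eq_or_lt_of_le (show (0:ℝ) ≤ x from hx) with h | h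
    · subst h; exact g4
    · exact (g3 x h).continuousAt.continuousWithinAt
  have hsm : StrictMonoOn φ' (Ici 0) := by
    apply strictMonoOn_of_hasDerivWithinAt_pos (convex_Ici 0) hc (f' := φ'')
    · intro x hx
      rw [interior_Ici] at hx
      exact (g3 x hx).hasDerivWithinAt
    · intro x hx
      rw [interior_Ici] at hx
      exact hpos x hx
  have hex : ∀ t, ∃ s, 0 < t → 0 < s ∧ φ' s = t := by
    intro t
    by_cases ht : 0 < t
    swap
    · exact ⟨0, fun h => absurd h ht⟩
    obtain ⟨b, hb, hb0⟩ := ((h6.eventually_ge_atTop t).and (eventually_ge_atTop 0)).exists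
    obtain ⟨s, hs, rfl⟩ := intermediate_value_Icc hb0 (hc.mono Icc_subset_Ici_self)
      (show t ∈ Icc (φ' 0) (φ' b) from ⟨by rw [h4]; exact ht.le, hb⟩)
    refine ⟨s, fun _ => ⟨lt_of_le_of_ne hs.1 ?_, rfl⟩⟩
    rintro rfl
    rw [h4] at ht; exact lt_irrefl _ ht
  choose g hg using hex
  have hgm : StrictMonoOn g (Ioi 0) := by
    intro x hx y hy hxy
    rw [← hsm.lt_iff_lt (mem_Ici.2 (hg x hx).1.le) (mem_Ici.2 (hg y hy).1.le), (hg x hx).2, (hg y hy).2]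
    exact hxy
  have him : Ioi 0 ⊆ g '' Ioi 0 := by
    intro s hs
    refine ⟨φ' s, h5 s hs, ?_⟩
    have := hg (φ' s) (h5 s hs)
    exact hsm.injOn (mem_Ici.2 this.1.le) (mem_Ici.2 (le_of_lt hs)) this.2
  refine ⟨g, hg, fun t ht => ?_⟩
  have hcg : ContinuousAt g t := hgm.continuousAt_of_image_mem_nhds (Ioi_mem_nhds ht)
    (mem_of_superset (Ioi_mem_nhds (hg t ht).1) him)
  apply HasDerivAt.of_local_left_inverse hcg (g3 _ (hg t ht).1) (hpos _ (hg t ht).1).ne'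
  filter_upwards [Ioi_mem_nhds ht] with y hy using (hg y hy).2

/-- Good `φ'` property implies that the conjugate `φ*` is twice differentiable on `(0,∞)`,
has the good `(φ*)'` property with a constant depending only on `G`, and satisfies Δ₂
with a constant depending only on `G`. -/
theorem goodPhi_conj :
    ∃ Gs Kf : ℝ → ℝ, ∀ (G : ℝ) (φ φ' φ'' : ℝ → ℝ),
      IsNFunction φ φ' → GoodPhi φ φ' φ'' G →
      1 ≤ Gs G ∧
      ∃ ψ' ψ'' : ℝ → ℝ,
        (∀ t, 0 < t → HasDerivAt (conjFn φ) (ψ' t) t) ∧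
        (∀ t, 0 < t → HasDerivAt ψ' (ψ'' t) t) ∧
        (∀ t, 0 < t → (Gs G)⁻¹ * ψ' t ≤ t * ψ'' t ∧ t * ψ'' t ≤ Gs G * ψ' t) ∧
        Delta2 (conjFn φ) (Kf G) := by
  refine ⟨fun G => G, fun G => 2 ^ (1 + G), fun G φ φ' φ'' hN hG => ⟨hG.1, ?_⟩⟩
  obtain ⟨g, hg, hgd⟩ := exists_inv φ φ' φ'' G hN hG
  have hce : ∀ t, 0 < t → conjFn φ t = t * g t - φ (g t) := by
    intro t ht
    have := conj_eq φ φ' hN (g t) (hg t ht).1.le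
    rwa [(hg t ht).2] at this
  have hcd : ∀ t, 0 < t → HasDerivAt (conjFn φ) (g t) t := by
    intro t ht
    have h1 := ((hasDerivAt_id t).mul (hgd t ht)).sub ((hG.2.1 (g t) (hg t ht).1).comp t (hgd t ht))
    rw [(hg t ht).2] at h1
    have h2 : HasDerivAt (fun x => x * g x - φ (g x)) (g t) t := by
      refine HasDerivAt.congr_deriv (f := fun x => x * g x - φ (g x)) h1 ?_
      simp only [id]
      ring
    apply h2.congr_of_eventuallyEq
    filter_upwards [Ioi_mem_nhds ht] with y hy using hce y hy
  have hGp : 0 < G := by linarith [hG.1]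
  refine ⟨g, fun t => (φ'' (g t))⁻¹, hcd, hgd, ?_, ?_⟩
  · intro t ht
    obtain ⟨hs, he⟩ := hg t ht
    obtain ⟨ha, hb⟩ := hG.2.2.2.2.2 (g t) hs
    rw [he] at ha hb
    have hp : 0 < φ'' (g t) :=
      pos_of_mul_pos_right ((mul_pos (inv_pos.2 hGp) ht).trans_le ha) hs.le
    rw [inv_mul_le_iff₀ hGp] at ha ⊢
    rw [← div_eq_mul_inv]
    constructor
    · rw [← mul_div_assoc, le_div_iff₀ hp]
      exact hb
    · rw [div_le_iff₀ hp]
      linarith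
  · have hkey : ∀ t, 0 < t → t * g t ≤ (1 + G) * conjFn φ t := by
      intro t ht
      have := phi_bound φ φ' φ'' G hN hG (g t) (hg t ht).1
      rw [(hg t ht).2] at this
      rw [hce t ht]
      linarith
    have hanti : AntitoneOn (fun t => conjFn φ t * t ^ (-(1 + G))) (Ioi 0) := by
      have hd : ∀ t, 0 < t → HasDerivAt (fun t => conjFn φ t * t ^ (-(1 + G)))
          (g t * t ^ (-(1 + G)) + conjFn φ t * (-(1 + G) * t ^ (-(1 + G) - 1))) t :=
        fun t ht => (hcd t ht).mul (Real.hasDerivAt_rpow_const (Or.inl ht.ne'))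
      apply antitoneOn_of_hasDerivWithinAt_nonpos (convex_Ioi 0)
        (f' := fun t => g t * t ^ (-(1 + G)) + conjFn φ t * (-(1 + G) * t ^ (-(1 + G) - 1)))
      · exact fun t ht => (hd t ht).continuousAt.continuousWithinAt
      · intro t ht
        rw [interior_Ioi] at ht
        exact (hd t ht).hasDerivWithinAt
      · intro t ht
        rw [interior_Ioi] at ht
        have ht' : 0 < t := ht
        have e : t ^ (-(1 + G)) = t ^ (-(1 + G) - 1) * t := by
          rw [← Real.rpow_add_one ht'.ne']; congr 1; ring
        have hp : 0 < t ^ (-(1 + G) - 1) := Real.rpow_pos_of_pos ht' _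
        have hk := hkey t ht'
        show g t * t ^ (-(1 + G)) + conjFn φ t * (-(1 + G) * t ^ (-(1 + G) - 1)) ≤ 0
        rw [e]
        nlinarith
    intro t ht
    rcases eq_or_lt_of_le ht with h | h
    · subst h
      have hc := conj_eq φ φ' hN 0 le_rfl
      have h0 : φ 0 = 0 := by simpa using hN.1 0 le_rfl
      rw [hN.2.2.2.1, h0] at hc
      simp [hc]
    · have h2 := hanti (mem_Ioi.2 h) (mem_Ioi.2 (show 0 < 2 * t by linarith))
        (by linarith : t ≤ 2 * t)
      have hp : 0 < t ^ (-(1 + G)) := Real.rpow_pos_of_pos h _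
      have hp2 : (0:ℝ) < 2 ^ (1 + G) := Real.rpow_pos_of_pos two_pos _
      simp only [Real.mul_rpow two_pos.le h.le, Real.rpow_neg two_pos.le] at h2
      rw [← mul_assoc] at h2
      have h3 := le_of_mul_le_mul_right h2 hp
      rw [← div_eq_mul_inv, div_le_iff₀ hp2] at h3
      show conjFn φ (2 * t) ≤ 2 ^ (1 + G) * conjFn φ t
      linarith
end
end

section
/- Let φ be an N-function with the good φ' property with constant G, and define its square-root function φ̄ by φ̄(t) = ∫₀ᵗ √(s·φ'(s)) ds, so φ̄'(t) = √(t·φ'(t)). Then φ̄ is an N-function, φ̄ has the good φ̄' property with a constant depending only on G, and there are constants c, C > 0 depending only on G such that c·√(φ''(t)) ≤ φ̄''(t) ≤ C·√(φ''(t)) for all t > 0 (Lemma 5). -/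
open MeasureTheory Real Set Filter

noncomputable section

/-- The square-root N-function `φ̄(t) = ∫₀ᵗ √(s·φ'(s)) ds`. -/
def barPhi (φ' : ℝ → ℝ) (t : ℝ) : ℝ := ∫ s in (0:ℝ)..t, Real.sqrt (s * φ' s)

/-- Derivative of the square-root N-function: `φ̄'(t) = √(t·φ'(t))`. -/
def barPhi' (φ' : ℝ → ℝ) (t : ℝ) : ℝ := Real.sqrt (t * φ' t)

/-- The square root `φ̄` of an N-function `φ` with the good `φ'` property is an
N-function, has the good `φ̄'` property with constant depending only on `G`, and
`φ̄''(t) ∼ √(φ''(t))` with constants depending only on `G`. -/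
theorem sqrt_nfunction_good :
    ∃ Gb c C : ℝ → ℝ, ∀ (G : ℝ) (φ φ' φ'' : ℝ → ℝ),
      IsNFunction φ φ' → GoodPhi φ φ' φ'' G →
      0 < c G ∧ 0 < C G ∧
      IsNFunction (barPhi φ') (barPhi' φ') ∧
      ∃ ψ'' : ℝ → ℝ,
        GoodPhi (barPhi φ') (barPhi' φ') ψ'' (Gb G) ∧
        ∀ t, 0 < t →
          c G * Real.sqrt (φ'' t) ≤ ψ'' t ∧ ψ'' t ≤ C G * Real.sqrt (φ'' t) := by
  refine ⟨fun G => G + 1, fun _ => 1, fun G => (1 + G) * G, ?_⟩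
  intro G φ φ' φ'' hN hG
  obtain ⟨-, hnn, hmono, h0, hpos, htop, hrc⟩ := hN
  obtain ⟨hG1, -, hd, hc0, hc, hb⟩ := hG
  have hcat : ∀ t, 0 < t → ContinuousAt (barPhi' φ') t := fun t ht =>
    Real.continuous_sqrt.continuousAt.comp (continuousAt_id.mul (hd t ht).continuousAt)
  have hrc' : ∀ t, 0 ≤ t → ContinuousWithinAt (barPhi' φ') (Set.Ici t) t := fun t ht =>
    Real.continuous_sqrt.continuousAt.comp_continuousWithinAt
      (continuousWithinAt_id.mul (hrc t ht))
  have hcon : ContinuousOn (barPhi' φ') (Set.Ici 0) := by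
    intro t ht
    rcases eq_or_lt_of_le (show (0:ℝ) ≤ t from ht) with h | h
    · subst h
      exact hrc' 0 le_rfl
    · exact (hcat t h).continuousWithinAt
  have hcon' : ContinuousOn (barPhi' φ') (Set.Ioi 0) := hcon.mono Set.Ioi_subset_Ici_self
  have hkey : ∀ t, 0 < t → 0 < φ'' t := by
    intro t ht
    have h1 := (hb t ht).1
    have h2 : 0 < G⁻¹ * φ' t := mul_pos (inv_pos.2 (by linarith)) (hpos t ht)
    exact pos_of_mul_pos_right (lt_of_lt_of_le h2 h1) ht.le
  refine ⟨one_pos, by positivity, ⟨fun t _ => rfl, fun s _ => Real.sqrt_nonneg _, ?_, ?_, ?_, ?_,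
    hrc'⟩, fun t => (φ' t + t * φ'' t) / (2 * Real.sqrt (t * φ' t)), ⟨by linarith, ?_, ?_,
    hrc' 0 le_rfl, ?_, ?_⟩, ?_⟩
  · intro s t hs hst
    exact Real.sqrt_le_sqrt (mul_le_mul hst (hmono s t hs hst) (hnn s hs) (hs.trans hst))
  · simp [barPhi']
  · intro t ht
    exact Real.sqrt_pos.2 (mul_pos ht (hpos t ht))
  · exact Real.tendsto_sqrt_atTop.comp (tendsto_id.atTop_mul_atTop₀ htop)
  · intro t ht
    refine intervalIntegral.integral_hasDerivAt_right (f := barPhi' φ') ?_ ?_ (hcat t ht)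
    · apply ContinuousOn.intervalIntegrable
      apply hcon.mono
      rw [Set.uIcc_of_le ht.le]
      exact Set.Icc_subset_Ici_self
    · exact hcon'.stronglyMeasurableAtFilter isOpen_Ioi t ht
  · intro t ht
    have h := ((hasDerivAt_id t).mul (hd t ht)).sqrt (mul_pos ht (hpos t ht)).ne'
    have e : barPhi' φ' = fun y => √(y * φ' y) := rfl
    rw [e]
    simpa using h
  · intro t ht
    have hr : 0 < Real.sqrt (t * φ' t) := Real.sqrt_pos.2 (mul_pos ht (hpos t ht))
    exact ((hd t ht).continuousAt.add (continuousAt_id.mul (hc t ht))).div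
      (continuousAt_const.mul (hcat t ht)) (by positivity)
  · intro t ht
    have hr : 0 < Real.sqrt (t * φ' t) := Real.sqrt_pos.2 (mul_pos ht (hpos t ht))
    have hrr : Real.sqrt (t * φ' t) ^ 2 = t * φ' t :=
      Real.sq_sqrt (mul_pos ht (hpos t ht)).le
    have ha := hpos t ht
    have hq := hkey t ht
    have hb2 := (hb t ht).2
    simp only [barPhi']
    set r := Real.sqrt (t * φ' t)
    have e : t * ((φ' t + t * φ'' t) / (2 * r)) = t * (φ' t + t * φ'' t) / (2 * r) := by ring
    rw [e]
    have hm : 0 < t * (t * φ'' t) := by positivity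
    constructor
    · rw [le_div_iff₀ (by positivity), inv_mul_eq_div, div_mul_eq_mul_div,
        div_le_iff₀ (by linarith)]
      have : r * (2 * r) = 2 * (t * φ' t) := by rw [← hrr]; ring
      rw [this]
      have h3 : 0 < t * φ' t := by positivity
      nlinarith
    · rw [div_le_iff₀ (by positivity)]
      have : (G + 1) * r * (2 * r) = 2 * (G + 1) * (t * φ' t) := by rw [← hrr]; ring
      rw [this]
      have h3 : 0 < t * φ' t := by positivity
      have h4 := mul_le_mul_of_nonneg_left hb2 ht.le
      nlinarith
  · intro t ht
    have hr : 0 < Real.sqrt (t * φ' t) := Real.sqrt_pos.2 (mul_pos ht (hpos t ht))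
    have hrr : Real.sqrt (t * φ' t) ^ 2 = t * φ' t :=
      Real.sq_sqrt (mul_pos ht (hpos t ht)).le
    have ha := hpos t ht
    have hq := hkey t ht
    obtain ⟨hb1, hb2⟩ := hb t ht
    have hs : 0 < Real.sqrt (φ'' t) := Real.sqrt_pos.2 hq
    have hss : Real.sqrt (φ'' t) ^ 2 = φ'' t := Real.sq_sqrt hq.le
    simp only
    set r := Real.sqrt (t * φ' t)
    set q := Real.sqrt (φ'' t)
    have hG0 : 0 < G := by linarith
    have hsq : (r * q) ^ 2 = φ' t * (t * φ'' t) := by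
      rw [mul_pow, hrr, hss]; ring
    have hB : 0 < t * φ'' t := by positivity
    generalize t * φ'' t = b at *
    generalize φ' t = a at *
    constructor
    · rw [le_div_iff₀ (by positivity)]
      have : r * q ≤ (a + b) / 2 := by
        refine (sq_le_sq₀ (by positivity) (by positivity)).1 ?_
        rw [hsq]; nlinarith [sq_nonneg (a - b)]
      nlinarith
    · rw [div_le_iff₀ (by positivity)]
      have h5 : a ≤ G * (r * q) := by
        have h6 : a ≤ G * b := by
          rwa [inv_mul_eq_div, div_le_iff₀' hG0] at hb1
        refine (sq_le_sq₀ (by positivity) (by positivity)).1 ?_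
        rw [mul_pow, hsq]
        have h7 : a * a ≤ a * (G * b) := mul_le_mul_of_nonneg_left h6 ha.le
        have h8 : 0 < a * (G * b) := by positivity
        nlinarith
      nlinarith
end
end

section
/- Let φ be an N-function with the good φ' property with constant G, and define its square-root function φ̄ by φ̄(t) = ∫₀ᵗ √(s·φ'(s)) ds. If φ satisfies the Δ₂ condition with constant K, then φ̄ satisfies the Δ₂ condition with a constant depending only on K (Δ₂-inheritance part of Lemma 5). -/
open MeasureTheory Real Set Filter

noncomputable section

theorem aux_sqrt_mono (φ' : ℝ → ℝ) (h0 : ∀ s, 0 ≤ s → 0 ≤ φ' s)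
    (hm : ∀ s t, 0 ≤ s → s ≤ t → φ' s ≤ φ' t) (a b : ℝ) (ha : 0 ≤ a) (hab : a ≤ b) :
    Real.sqrt (a * φ' a) ≤ Real.sqrt (b * φ' b) :=
  Real.sqrt_le_sqrt (mul_le_mul hab (hm a b ha hab) (h0 a ha) (ha.trans hab))

theorem aux_key (K : ℝ) (φ φ' : ℝ → ℝ) (hN : IsNFunction φ φ') (hD : Delta2 φ K)
    (s : ℝ) (hs : 0 ≤ s) : 2 * s * φ' (2 * s) ≤ K ^ 2 * (s * φ' s) := by
  obtain ⟨hφ, h0, hm, -⟩ := hN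
  have hint : ∀ a b, 0 ≤ a → a ≤ b → IntervalIntegrable φ' volume a b := by
    intro a b ha hab
    apply MonotoneOn.intervalIntegrable
    rw [uIcc_of_le hab]
    intro x hx y hy hxy
    exact hm x y (ha.trans hx.1) hxy
  have hnn : ∀ t, 0 ≤ t → 0 ≤ φ t := by
    intro t ht
    rw [hφ t ht]
    exact intervalIntegral.integral_nonneg ht (fun x hx => h0 x hx.1)
  have hup : φ s ≤ s * φ' s := by
    rw [hφ s hs]
    have := intervalIntegral.integral_mono_on (μ := volume) hs (hint 0 s le_rfl hs)
      (intervalIntegrable_const (c := φ' s)) (fun x hx => hm x s hx.1 hx.2)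
    simpa using this
  have hlow : 2 * s * φ' (2 * s) ≤ φ (2 * (2 * s)) := by
    have h2 : 0 ≤ 2 * s := by linarith
    have h4 : 2 * s ≤ 2 * (2 * s) := by linarith
    rw [hφ _ (h2.trans h4), ← intervalIntegral.integral_add_adjacent_intervals
      (hint 0 (2 * s) le_rfl h2) (hint _ _ h2 h4)]
    have h := intervalIntegral.integral_mono_on (μ := volume) h4
      (intervalIntegrable_const (c := φ' (2 * s))) (hint _ _ h2 h4)
      (fun x hx => hm (2 * s) x h2 hx.1)
    rw [intervalIntegral.integral_const, smul_eq_mul] at h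
    have := hnn _ h2
    rw [hφ _ h2] at this
    linarith
  have h1 := hD s hs
  have h2 := hD (2 * s) (by linarith)
  have n1 := hnn s hs
  have n2 := hnn (2 * s) (by linarith)
  have h3 : φ (2 * (2 * s)) ≤ K ^ 2 * φ s := by
    rcases le_total 0 K with hK | hK
    · nlinarith [mul_le_mul_of_nonneg_left h1 hK]
    · nlinarith [mul_nonneg (sq_nonneg K) n1, mul_nonneg (neg_nonneg.2 hK) n2]
  nlinarith [mul_le_mul_of_nonneg_left hup (sq_nonneg K)]

/-- The square root `φ̄` inherits the Δ₂ condition from `φ`, with a constant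
depending only on `K`. -/
theorem sqrt_nfunction_delta2 :
    ∃ Kb : ℝ → ℝ, ∀ (K G : ℝ) (φ φ' φ'' : ℝ → ℝ),
      IsNFunction φ φ' → GoodPhi φ φ' φ'' G → Delta2 φ K →
      Delta2 (barPhi φ') (Kb K) := by
  refine ⟨fun K => 2 * |K|, ?_⟩
  intro K G φ φ' φ'' hN _ hD t ht
  have h0 := hN.2.1
  have hm := hN.2.2.1
  have e : barPhi φ' (2 * t) = 2 * ∫ s in (0:ℝ)..t, Real.sqrt (2 * s * φ' (2 * s)) := by
    have := intervalIntegral.smul_integral_comp_mul_left (a := 0) (b := t)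
      (fun s => Real.sqrt (s * φ' s)) 2
    simp only [smul_eq_mul, mul_zero] at this
    rw [barPhi, ← this]
  rw [e, barPhi, mul_assoc, ← intervalIntegral.integral_const_mul |K|]
  refine mul_le_mul_of_nonneg_left ?_ (by norm_num)
  apply intervalIntegral.integral_mono_on ht
  · apply MonotoneOn.intervalIntegrable
    rw [uIcc_of_le ht]
    intro x hx y hy hxy
    exact aux_sqrt_mono φ' h0 hm _ _ (by linarith [hx.1]) (by linarith)
  · apply IntervalIntegrable.const_mul
    apply MonotoneOn.intervalIntegrable
    rw [uIcc_of_le ht]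
    intro x hx y hy hxy
    exact aux_sqrt_mono φ' h0 hm _ _ hx.1 hxy
  · intro x hx
    rw [← Real.sqrt_sq_eq_abs, ← Real.sqrt_mul (sq_nonneg K)]
    exact Real.sqrt_le_sqrt (aux_key K φ φ' hN hD x hx.1)
end
end

section
/- Let φ be an N-function with the good φ' property with constant G, let d ≥ 1, and define the tensor T on real symmetric d×d matrices by T(Q) = φ'(|Q|)·Q/|Q| for Q ≠ 0 and T(0) = 0. Then there exist constants c, C > 0 depending only on G such that for all symmetric d×d matrices P, Q with |P| + |Q| > 0: (T(P) − T(Q)):(P − Q) ≥ c·φ''(|P| + |Q|)·|P − Q|² and |T(P) − T(Q)| ≤ C·φ''(|P| + |Q|)·|P − Q| (Proposition 3). -/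
open MeasureTheory Real Set Filter

noncomputable section

/-- Frobenius inner product `P : Q = ∑ᵢⱼ Pᵢⱼ·Qᵢⱼ`. -/
def minner {d : ℕ} (P Q : Matrix (Fin d) (Fin d) ℝ) : ℝ := ∑ i, ∑ j, P i j * Q i j

/-- Frobenius norm `|P| = √(P : P)`. -/
def fnorm {d : ℕ} (P : Matrix (Fin d) (Fin d) ℝ) : ℝ := Real.sqrt (minner P P)

/-- The tensor `Q ↦ g(|Q|)·Q/|Q|` (with value `0` at `Q = 0`). -/
def tensorT {d : ℕ} (g : ℝ → ℝ) (Q : Matrix (Fin d) (Fin d) ℝ) :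
    Matrix (Fin d) (Fin d) ℝ :=
  if Q = 0 then 0 else (g (fnorm Q) / fnorm Q) • Q

lemma tg_sum_prod {d : ℕ} (P Q : Matrix (Fin d) (Fin d) ℝ) :
    minner P Q = ∑ k : Fin d × Fin d, P k.1 k.2 * Q k.1 k.2 := by
  rw [minner, Fintype.sum_prod_type]

lemma tg_self_nonneg {d : ℕ} (P : Matrix (Fin d) (Fin d) ℝ) : 0 ≤ minner P P := by
  rw [tg_sum_prod]
  exact Finset.sum_nonneg fun k _ => mul_self_nonneg _

lemma tg_fnorm_sq {d : ℕ} (P : Matrix (Fin d) (Fin d) ℝ) : fnorm P ^ 2 = minner P P :=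
  Real.sq_sqrt (tg_self_nonneg P)

lemma tg_fnorm_nonneg {d : ℕ} (P : Matrix (Fin d) (Fin d) ℝ) : 0 ≤ fnorm P :=
  Real.sqrt_nonneg _

lemma tg_cs {d : ℕ} (P Q : Matrix (Fin d) (Fin d) ℝ) :
    |minner P Q| ≤ fnorm P * fnorm Q := by
  refine abs_le_of_sq_le_sq ?_ (mul_nonneg (tg_fnorm_nonneg P) (tg_fnorm_nonneg Q))
  rw [mul_pow, tg_fnorm_sq, tg_fnorm_sq, tg_sum_prod, tg_sum_prod, tg_sum_prod]
  have := Finset.sum_mul_sq_le_sq_mul_sq Finset.univ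
    (fun k : Fin d × Fin d => P k.1 k.2) (fun k => Q k.1 k.2)
  simpa [sq] using this

lemma tg_expand {d : ℕ} (P Q : Matrix (Fin d) (Fin d) ℝ) (p q r s : ℝ) :
    minner (p • P - q • Q) (r • P - s • Q) =
      p * r * minner P P - (p * s + q * r) * minner P Q + q * s * minner Q Q := by
  simp only [tg_sum_prod, Finset.mul_sum, ← Finset.sum_add_distrib, ← Finset.sum_sub_distrib]
  refine Finset.sum_congr rfl fun k _ => ?_
  simp only [Matrix.sub_apply, Matrix.smul_apply, smul_eq_mul]
  ring

lemma tg_tensor {d : ℕ} (g : ℝ → ℝ) (Q : Matrix (Fin d) (Fin d) ℝ) :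
    tensorT g Q = (g (fnorm Q) / fnorm Q) • Q := by
  unfold tensorT
  split_ifs with h
  · rw [h, smul_zero]
  · rfl

/-- mean value theorem for `log φ'` -/
lemma tg_log_mvt {φ φ' φ'' : ℝ → ℝ} {G : ℝ} (hN : IsNFunction φ φ') (hG : GoodPhi φ φ' φ'' G)
    {b a : ℝ} (hb : 0 < b) (hab : b < a) :
    ∃ ξ, b < ξ ∧ ξ < a ∧
      Real.log (φ' a) - Real.log (φ' b) = φ'' ξ / φ' ξ * (a - b) := by
  obtain ⟨-, -, -, -, hpos, -, -⟩ := hN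
  obtain ⟨-, -, hd, -, -, -⟩ := hG
  have hder : ∀ t, 0 < t → HasDerivAt (fun t => Real.log (φ' t)) (φ'' t / φ' t) t :=
    fun t ht => (hd t ht).log (hpos t ht).ne'
  obtain ⟨ξ, hξ, h⟩ := exists_hasDerivAt_eq_slope (fun t => Real.log (φ' t))
    (fun t => φ'' t / φ' t) hab
    (fun t ht => (hder t (hb.trans_le ht.1)).continuousAt.continuousWithinAt)
    (fun t ht => hder t (hb.trans ht.1))
  refine ⟨ξ, hξ.1, hξ.2, ?_⟩
  have : 0 < a - b := sub_pos.2 hab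
  rw [h]
  field_simp

lemma tg_doubling {φ φ' φ'' : ℝ → ℝ} {G : ℝ} (hN : IsNFunction φ φ') (hG : GoodPhi φ φ' φ'' G)
    {a : ℝ} (ha : 0 < a) : φ' (2 * a) ≤ Real.exp G * φ' a := by
  obtain ⟨ξ, h1, h2, h⟩ := tg_log_mvt hN hG ha (show a < 2 * a by linarith)
  obtain ⟨-, -, -, -, hpos, -, -⟩ := hN
  obtain ⟨hG1, -, -, -, -, hb⟩ := hG
  have hξ : 0 < ξ := ha.trans h1
  have hgξ := hpos ξ hξ
  have h3 : φ'' ξ / φ' ξ * (2 * a - a) ≤ G := by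
    have := (hb ξ hξ).2
    rw [div_mul_eq_mul_div, div_le_iff₀ hgξ]
    have h0 : 0 ≤ φ'' ξ := by
      have h4 := (hb ξ hξ).1
      have : 0 < G⁻¹ * φ' ξ := by positivity
      exact le_of_lt (pos_of_mul_pos_right (this.trans_le h4) hξ.le)
    nlinarith
  have h5 : Real.log (φ' (2 * a)) ≤ G + Real.log (φ' a) := by linarith
  have h6 := Real.exp_le_exp.2 h5
  rwa [Real.exp_add, Real.exp_log (hpos _ ha), Real.exp_log (hpos _ (by linarith))] at h6

lemma tg_lower {φ φ' φ'' : ℝ → ℝ} {G : ℝ} (hN : IsNFunction φ φ') (hG : GoodPhi φ φ' φ'' G)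
    {b a : ℝ} (ha : 0 < a) (hb : 0 ≤ b) (hab : b ≤ a) :
    φ' a / a * (a - b) / (2 * G) ≤ φ' a - φ' b := by
  have hG1 : 1 ≤ G := hG.1
  have hga : 0 < φ' a := hN.2.2.2.2.1 a ha
  rcases hab.eq_or_lt with rfl | hab
  · simp
  rcases hb.eq_or_lt with rfl | hb
  · rw [hN.2.2.2.1, div_le_iff₀ (by positivity)]
    have : φ' a / a * (a - 0) = φ' a := by field_simp; ring
    rw [this]; nlinarith
  obtain ⟨ξ, h1, h2, h⟩ := tg_log_mvt hN hG hb hab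
  obtain ⟨-, -, -, -, hpos, -, -⟩ := hN
  obtain ⟨-, -, -, -, -, hbd⟩ := hG
  have hξ : 0 < ξ := hb.trans h1
  have hgξ := hpos ξ hξ
  have hgb := hpos b hb
  set u := (a - b) / (G * a) with hu
  have hu0 : 0 ≤ u := div_nonneg (by linarith) (by positivity)
  have hu1 : u ≤ 1 := by
    rw [hu, div_le_one (by positivity)]; nlinarith
  have h3 : u ≤ φ'' ξ / φ' ξ * (a - b) := by
    have h4 := (hbd ξ hξ).1
    have h5 : 1 / (G * a) ≤ φ'' ξ / φ' ξ := by
      rw [div_le_div_iff₀ (by positivity) hgξ]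
      have h6 : φ' ξ ≤ G * (ξ * φ'' ξ) := by
        have := mul_le_mul_of_nonneg_left h4 (show (0:ℝ) ≤ G by linarith)
        rwa [← mul_assoc, mul_inv_cancel₀ (by linarith), one_mul] at this
      have h0 : 0 ≤ φ'' ξ := by
        have : 0 < G⁻¹ * φ' ξ := by positivity
        exact le_of_lt (pos_of_mul_pos_right (this.trans_le h4) hξ.le)
      have h7 : ξ * φ'' ξ ≤ a * φ'' ξ := mul_le_mul_of_nonneg_right h2.le h0
      nlinarith
    have := mul_le_mul_of_nonneg_right h5 (show 0 ≤ a - b by linarith)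
    rwa [one_div_mul_eq_div] at this
  have h5 : u + Real.log (φ' b) ≤ Real.log (φ' a) := by linarith
  have h6 := Real.exp_le_exp.2 h5
  rw [Real.exp_add, Real.exp_log hgb, Real.exp_log hga] at h6
  have h7 := Real.add_one_le_exp u
  have h8 : (1 + u) * φ' b ≤ φ' a := by nlinarith
  have h9 : φ' a / a * (a - b) / (2 * G) = φ' a * u / 2 := by
    rw [hu]; field_simp
  rw [h9]
  have h10 : 0 ≤ φ' a - φ' b := by nlinarith
  nlinarith

lemma tg_upper {φ φ' φ'' : ℝ → ℝ} {G : ℝ} (hN : IsNFunction φ φ') (hG : GoodPhi φ φ' φ'' G)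
    {b a : ℝ} (ha : 0 < a) (hb : a / 2 ≤ b) (hab : b ≤ a) :
    φ' a - φ' b ≤ 2 * G * (φ' a / a) * (a - b) := by
  rcases hab.eq_or_lt with rfl | hab
  · simp
  obtain ⟨-, -, hmono, -, hpos, -, -⟩ := hN
  obtain ⟨hG1, -, hd, -, -, hbd⟩ := hG
  have hb0 : 0 < b := by linarith
  obtain ⟨ξ, hξ, h⟩ := exists_hasDerivAt_eq_slope φ' φ'' hab
    (fun t ht => (hd t (hb0.trans_le ht.1)).continuousAt.continuousWithinAt)
    (fun t ht => hd t (hb0.trans ht.1))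
  have hξ0 : 0 < ξ := hb0.trans hξ.1
  have hs : 0 < a - b := sub_pos.2 hab
  rw [eq_div_iff hs.ne'] at h
  rw [← h]
  apply mul_le_mul_of_nonneg_right _ hs.le
  have h1 := (hbd ξ hξ0).2
  have h2 := hmono ξ a hξ0.le hξ.2.le
  have hga := hpos a ha
  have h3 : φ'' ξ ≤ G * φ' a / ξ := by
    rw [le_div_iff₀ hξ0]; nlinarith
  refine h3.trans ?_
  rw [div_le_iff₀ hξ0]
  have h4 : a ≤ 2 * ξ := by linarith [hξ.1]
  have h5 : 2 * G * (φ' a / a) * ξ = G * φ' a * (2 * ξ / a) := by ring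
  rw [h5]
  have : 1 ≤ 2 * ξ / a := by rwa [le_div_iff₀ ha, one_mul]
  have h6 : 0 ≤ G * φ' a := by positivity
  nlinarith

lemma tg_core {φ φ' φ'' : ℝ → ℝ} {G : ℝ} (hN : IsNFunction φ φ') (hG : GoodPhi φ φ' φ'' G)
    {d : ℕ} (P Q : Matrix (Fin d) (Fin d) ℝ) (ha : 0 < fnorm P) (hab : fnorm Q ≤ fnorm P) :
    φ' (fnorm P) / fnorm P / (2 * G) * fnorm (P - Q) ^ 2 ≤
        minner (tensorT φ' P - tensorT φ' Q) (P - Q) ∧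
      fnorm (tensorT φ' P - tensorT φ' Q) ≤
        4 * G * (φ' (fnorm P) / fnorm P) * fnorm (P - Q) := by
  have hG1 : 1 ≤ G := hG.1
  have hb := tg_fnorm_nonneg Q
  have hD0 := tg_fnorm_nonneg (P - Q)
  have hcs := abs_le.1 (tg_cs P Q)
  have hPQ : P - Q = (1:ℝ) • P - (1:ℝ) • Q := by simp
  have hD : fnorm (P - Q) ^ 2 = (fnorm P - fnorm Q) ^ 2 +
      2 * (fnorm P * fnorm Q - minner P Q) := by
    rw [tg_fnorm_sq, hPQ, tg_expand, ← tg_fnorm_sq, ← tg_fnorm_sq]; ring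
  have hI : minner (tensorT φ' P - tensorT φ' Q) (P - Q) =
      φ' (fnorm P) / fnorm P * fnorm P ^ 2 - (φ' (fnorm P) / fnorm P + φ' (fnorm Q) / fnorm Q) *
        minner P Q + φ' (fnorm Q) / fnorm Q * fnorm Q ^ 2 := by
    rw [tg_tensor, tg_tensor, hPQ, tg_expand, ← tg_fnorm_sq, ← tg_fnorm_sq]; ring
  have hT : fnorm (tensorT φ' P - tensorT φ' Q) ^ 2 =
      (φ' (fnorm P) / fnorm P) ^ 2 * fnorm P ^ 2 -
        2 * (φ' (fnorm P) / fnorm P) * (φ' (fnorm Q) / fnorm Q) *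
        minner P Q + (φ' (fnorm Q) / fnorm Q) ^ 2 * fnorm Q ^ 2 := by
    rw [tg_fnorm_sq, tg_tensor, tg_tensor, tg_expand, ← tg_fnorm_sq, ← tg_fnorm_sq]; ring
  have hlow := tg_lower hN hG ha hb hab
  have hupp := fun h => tg_upper hN hG ha (b := fnorm Q) h hab
  have hga := hN.2.2.2.2.1 _ ha
  have hgb := hN.2.1 _ hb
  have hgab := hN.2.2.1 _ _ hb hab
  have hg0 := hN.2.2.2.1
  generalize fnorm P = a at *
  generalize fnorm Q = b at *
  generalize fnorm (P - Q) = D at *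
  generalize minner P Q = x at *
  have hpa : φ' a / a * a = φ' a := by field_simp
  have hqb : φ' b / b * b = φ' b := by
    rcases eq_or_ne b 0 with rfl | h
    · simp [hg0]
    · field_simp
  have hp : 0 < φ' a / a := by positivity
  have hq : 0 ≤ φ' b / b := by positivity
  have hq2 : a / 2 ≤ b → φ' b / b ≤ 2 * (φ' a / a) := by
    intro h
    have hb0 : 0 < b := by linarith
    rw [div_le_iff₀ hb0]
    nlinarith
  generalize φ' a / a = p at *
  generalize φ' b / b = q at *
  rw [← hpa, ← hqb] at hlow hgab hupp
  rw [← hqb] at hgb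
  clear hpa hqb hga hPQ hg0
  have hy : 0 ≤ a * b - x := by linarith
  have hy2 : a * b - x ≤ 2 * (a * b) := by linarith
  constructor
  · rw [hI, hD]
    have e1 : p * a ^ 2 - (p + q) * x + q * b ^ 2 =
        (p * a - q * b) * (a - b) + (p + q) * (a * b - x) := by ring
    rw [e1]
    have e2 : p / (2 * G) * ((a - b) ^ 2 + 2 * (a * b - x)) =
      p * (a - b) / (2 * G) * (a - b) + p / G * (a * b - x) := by field_simp
    rw [e2]
    have e3 : p / G ≤ p + q := (div_le_self hp.le hG1).trans (by linarith)
    have := mul_le_mul_of_nonneg_right hlow (sub_nonneg.2 hab)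
    have := mul_le_mul_of_nonneg_right e3 hy
    linarith
  · refine (pow_le_pow_iff_left₀ (tg_fnorm_nonneg _) (by positivity) two_ne_zero).1 ?_
    rw [hT, mul_pow, hD]
    have e1 : p ^ 2 * a ^ 2 - 2 * p * q * x + q ^ 2 * b ^ 2 =
        (p * a - q * b) ^ 2 + 2 * (p * q) * (a * b - x) := by ring
    rw [e1]
    have hGp : (4 * p) ^ 2 ≤ (4 * G * p) ^ 2 := by
      apply pow_le_pow_left₀ (by positivity)
      nlinarith
    rcases le_total (a / 2) b with h | h
    · have h1 := pow_le_pow_left₀ (sub_nonneg.2 hgab) (hupp h) 2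
      have h2 : p * q ≤ 2 * p ^ 2 := by nlinarith [hq2 h]
      have h3 := mul_le_mul_of_nonneg_right h2 hy
      have h4 := mul_le_mul_of_nonneg_right hGp hy
      have h5 : 0 ≤ p ^ 2 * (a * b - x) := by positivity
      have h6 : 0 ≤ (G * p * (a - b)) ^ 2 := sq_nonneg _
      nlinarith
    · have h1 : 2 * (p * q) * (a * b - x) ≤ 2 * (p * q) * (2 * (a * b)) :=
        mul_le_mul_of_nonneg_left hy2 (by positivity)
      have h2 : (p * a + q * b) ^ 2 ≤ (2 * (p * a)) ^ 2 := 
        pow_le_pow_left₀ (by positivity) (by linarith) 2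
      have h3 : (a / 2) ^ 2 ≤ (a - b) ^ 2 := pow_le_pow_left₀ (by positivity) (by linarith) 2
      have h4 : (4 * p) ^ 2 * (a / 2) ^ 2 ≤ (4 * G * p) ^ 2 * ((a - b) ^ 2 + 2 * (a * b - x)) :=
        mul_le_mul hGp (by linarith) (by positivity) (by positivity)
      nlinarith

lemma tg_ordered {φ φ' φ'' : ℝ → ℝ} {G : ℝ} (hN : IsNFunction φ φ') (hG : GoodPhi φ φ' φ'' G)
    {d : ℕ} (P Q : Matrix (Fin d) (Fin d) ℝ) (hs : 0 < fnorm P + fnorm Q)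
    (hab : fnorm Q ≤ fnorm P) :
    1 / (2 * G ^ 2 * Real.exp G) * φ'' (fnorm P + fnorm Q) * fnorm (P - Q) ^ 2 ≤
        minner (tensorT φ' P - tensorT φ' Q) (P - Q) ∧
      fnorm (tensorT φ' P - tensorT φ' Q) ≤
        8 * G ^ 2 * φ'' (fnorm P + fnorm Q) * fnorm (P - Q) := by
  have ha : 0 < fnorm P := by linarith
  have hb := tg_fnorm_nonneg Q
  have hD0 := tg_fnorm_nonneg (P - Q)
  obtain ⟨h1, h2⟩ := tg_core hN hG P Q ha hab
  have hdb := tg_doubling hN hG ha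
  have hG1 : 1 ≤ G := hG.1
  obtain ⟨h3, h4⟩ := hG.2.2.2.2.2 _ hs
  have hm1 := hN.2.2.1 (fnorm P) (fnorm P + fnorm Q) ha.le (by linarith)
  have hm2 := hN.2.2.1 (fnorm P + fnorm Q) (2 * fnorm P) hs.le (by linarith)
  have hga := hN.2.2.2.2.1 _ ha
  have hgs := hN.2.2.2.2.1 _ hs
  have hE := Real.exp_pos G
  have hpp : 0 < φ'' (fnorm P + fnorm Q) := by
    have : 0 < G⁻¹ * φ' (fnorm P + fnorm Q) := by positivity
    exact pos_of_mul_pos_right (this.trans_le h3) hs.le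
  constructor
  · refine le_trans ?_ h1
    apply mul_le_mul_of_nonneg_right _ (sq_nonneg _)
    have k : fnorm P * φ'' (fnorm P + fnorm Q) ≤ G * (Real.exp G * φ' (fnorm P)) := by
      nlinarith [mul_nonneg hb hpp.le]
    rw [div_div, one_div_mul_eq_div, div_le_div_iff₀ (by positivity) (by positivity)]
    have := mul_le_mul_of_nonneg_left k (show 0 ≤ 2 * G by linarith)
    linarith
  · refine h2.trans ?_
    apply mul_le_mul_of_nonneg_right _ hD0
    have k : φ' (fnorm P) / fnorm P ≤ 2 * G * φ'' (fnorm P + fnorm Q) := by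
      rw [div_le_iff₀ ha]
      have h6 := mul_le_mul_of_nonneg_left h3 (show (0:ℝ) ≤ G by linarith)
      rw [← mul_assoc, mul_inv_cancel₀ (by linarith), one_mul] at h6
      have : (fnorm P + fnorm Q) * φ'' (fnorm P + fnorm Q) ≤
        2 * fnorm P * φ'' (fnorm P + fnorm Q) :=
        mul_le_mul_of_nonneg_right (by linarith) hpp.le
      nlinarith
    have := mul_le_mul_of_nonneg_left k (show 0 ≤ 4 * G by linarith)
    linarith

lemma tg_fnorm_comm {d : ℕ} (P Q : Matrix (Fin d) (Fin d) ℝ) : fnorm (P - Q) = fnorm (Q - P) := by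
  rw [fnorm, fnorm]
  congr 1
  simp only [tg_sum_prod, Matrix.sub_apply]
  exact Finset.sum_congr rfl fun k _ => by ring

lemma tg_minner_comm {d : ℕ} (A B P Q : Matrix (Fin d) (Fin d) ℝ) :
    minner (A - B) (P - Q) = minner (B - A) (Q - P) := by
  simp only [tg_sum_prod, Matrix.sub_apply]
  exact Finset.sum_congr rfl fun k _ => by ring

/-- Proposition 3: monotonicity and growth for the tensor `T(Q) = φ'(|Q|)·Q/|Q|`. -/
theorem tensor_monotonicity_growth :
    ∃ c C : ℝ → ℝ, ∀ (G : ℝ) (d : ℕ) (φ φ' φ'' : ℝ → ℝ),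
      IsNFunction φ φ' → GoodPhi φ φ' φ'' G → 1 ≤ d →
      0 < c G ∧ 0 < C G ∧
      ∀ P Q : Matrix (Fin d) (Fin d) ℝ, P.IsSymm → Q.IsSymm →
        0 < fnorm P + fnorm Q →
        c G * φ'' (fnorm P + fnorm Q) * fnorm (P - Q) ^ 2 ≤
          minner (tensorT φ' P - tensorT φ' Q) (P - Q) ∧
        fnorm (tensorT φ' P - tensorT φ' Q) ≤
          C G * φ'' (fnorm P + fnorm Q) * fnorm (P - Q) := by
  refine ⟨fun G => 1 / (2 * G ^ 2 * Real.exp G), fun G => 8 * G ^ 2, ?_⟩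
  intro G d φ φ' φ'' hN hG _
  have hG0 : 0 < G := lt_of_lt_of_le one_pos hG.1
  refine ⟨by positivity, by positivity, ?_⟩
  intro P Q _ _ hs
  rcases le_total (fnorm Q) (fnorm P) with h | h
  · exact tg_ordered hN hG P Q hs h
  · have := tg_ordered hN hG Q P (by linarith) h
    rwa [tg_minner_comm, tg_fnorm_comm Q P, tg_fnorm_comm (tensorT φ' Q), add_comm] at this
end
end

section
/- Let φ be an N-function with the good φ' property with constant G and, for a ≥ 0, let φ_a be the shifted N-function φ_a(t) = ∫₀ᵗ φ'(a+s)·s/(a+s) ds. Then for every a ≥ 0 the function φ_a is an N-function, twice differentiable on (0,∞), there are constants c, C > 0 depending only on G (uniform in a) such that c·φ'(a+t)/(a+t) ≤ φ_a''(t) ≤ C·φ'(a+t)/(a+t) and c·φ''(a+t) ≤ φ_a''(t) ≤ C·φ''(a+t) for all t > 0, and φ_a has the good φ_a' property with a constant depending only on G, uniformly in a (part of Lemma 6). -/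
open MeasureTheory Real Set Filter

noncomputable section

/-- Shifted N-function `φ_a(t) = ∫₀ᵗ φ'(a+s)·s/(a+s) ds`. -/
def shPhi (φ' : ℝ → ℝ) (a t : ℝ) : ℝ := ∫ s in (0:ℝ)..t, φ' (a + s) * s / (a + s)

/-- Derivative of the shifted N-function: `φ'_a(t) = φ'(a+t)·t/(a+t)`. -/
def shPhi' (φ' : ℝ → ℝ) (a t : ℝ) : ℝ := φ' (a + t) * t / (a + t)

theorem sh_hasDerivAt {φ φ' φ'' : ℝ → ℝ} {G : ℝ} (h2 : GoodPhi φ φ' φ'' G)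
    {a t : ℝ} (ha : 0 ≤ a) (ht : 0 < t) :
    HasDerivAt (shPhi' φ' a)
      (φ'' (a + t) * t / (a + t) + φ' (a + t) * a / (a + t) ^ 2) t := by
  obtain ⟨_, _, hd, _, _, _⟩ := h2
  have hu : 0 < a + t := by linarith
  have h1 : HasDerivAt (fun s : ℝ => a + s) 1 t := (hasDerivAt_id t).const_add a
  have h3 : HasDerivAt (fun s : ℝ => φ' (a + s)) (φ'' (a + t) * 1) t :=
    HasDerivAt.comp t (hd _ hu) h1
  have h4 := (h3.mul (hasDerivAt_id t)).div h1 hu.ne'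
  refine h4.congr_deriv ?_
  simp only [Pi.mul_apply, id]
  field_simp
  ring

theorem sh_cwa_zero {φ φ' φ'' : ℝ → ℝ} {G : ℝ} (h1 : IsNFunction φ φ')
    (h2 : GoodPhi φ φ' φ'' G) {a : ℝ} (ha : 0 ≤ a) :
    ContinuousWithinAt (shPhi' φ' a) (Ici 0) 0 := by
  obtain ⟨_, _, _, h0, _, _, _⟩ := h1
  obtain ⟨_, _, hd, hc, _, _⟩ := h2
  rcases ha.eq_or_lt with rfl | ha
  · have key : ∀ y, shPhi' φ' 0 y = φ' y := by
      intro y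
      by_cases hy : y = 0
      · subst hy; simp [shPhi', h0]
      · simp [shPhi', hy]
    exact hc.congr (fun y _ => key y) (key 0)
  · apply ContinuousAt.continuousWithinAt
    have h3 : ContinuousAt (fun s : ℝ => φ' (a + s)) 0 := by
      apply ContinuousAt.comp (f := fun s : ℝ => a + s) (g := φ')
      · exact (hd _ (by simpa using ha)).continuousAt
      · fun_prop
    exact (h3.mul continuousAt_id).div (by fun_prop) (by simpa using ha.ne')

theorem sh_contOn {φ φ' φ'' : ℝ → ℝ} {G : ℝ} (h1 : IsNFunction φ φ')
    (h2 : GoodPhi φ φ' φ'' G) {a : ℝ} (ha : 0 ≤ a) :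
    ContinuousOn (shPhi' φ' a) (Ici 0) := by
  intro t ht
  rcases (mem_Ici.1 ht).eq_or_lt with rfl | ht
  · exact sh_cwa_zero h1 h2 ha
  · exact (sh_hasDerivAt h2 ha ht).continuousAt.continuousWithinAt

theorem sh_isN {φ φ' φ'' : ℝ → ℝ} {G : ℝ} (h1 : IsNFunction φ φ')
    (h2 : GoodPhi φ φ' φ'' G) {a : ℝ} (ha : 0 ≤ a) :
    IsNFunction (shPhi φ' a) (shPhi' φ' a) := by
  have hcont := sh_contOn h1 h2 ha
  obtain ⟨_, hnn, hmono, h0, hpos, htop, _⟩ := h1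
  have hnn' : ∀ s, 0 ≤ s → 0 ≤ shPhi' φ' a s := fun s hs =>
    div_nonneg (mul_nonneg (hnn _ (by linarith)) hs) (by linarith)
  refine ⟨fun t _ => rfl, hnn', ?_, by simp [shPhi'], ?_, ?_, ?_⟩
  · intro s t hs hst
    rcases hs.eq_or_lt with rfl | hs
    · have := hnn' t hst
      simpa [shPhi'] using this
    · unfold shPhi'
      rw [mul_div_assoc, mul_div_assoc]
      apply mul_le_mul (hmono _ _ (by linarith) (by linarith)) _
        (div_nonneg hs.le (by linarith)) (hnn _ (by linarith))
      rw [div_le_div_iff₀ (by linarith) (by linarith)]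
      nlinarith
  · intro t ht
    exact div_pos (mul_pos (hpos _ (by linarith)) ht) (by linarith)
  · have h3 : Tendsto (fun t => φ' t * (1 / 2)) atTop atTop :=
      htop.atTop_mul_const (by norm_num)
    refine tendsto_atTop_mono' _ ?_ h3
    filter_upwards [eventually_ge_atTop (a + 1)] with t ht
    have e1 := hmono t (a + t) (by linarith) (by linarith)
    unfold shPhi'
    rw [mul_div_assoc]
    apply mul_le_mul e1 _ (by norm_num) (hnn _ (by linarith))
    rw [div_le_div_iff₀ (by norm_num) (by linarith)]
    linarith
  · intro t ht
    exact (hcont t ht).mono (Ici_subset_Ici.2 ht)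

theorem sh_bounds {G p q a t : ℝ} (hG : 1 ≤ G) (ha : 0 ≤ a) (ht : 0 < t) (hp : 0 < p)
    (hl : G⁻¹ * p ≤ (a + t) * q) (hu : (a + t) * q ≤ G * p) :
    G⁻¹ * (p / (a + t)) ≤ q * t / (a + t) + p * a / (a + t) ^ 2 ∧
    q * t / (a + t) + p * a / (a + t) ^ 2 ≤ G * (p / (a + t)) := by
  have hut : 0 < a + t := by linarith
  have hGi : G⁻¹ ≤ 1 := inv_le_one_of_one_le₀ hG
  have e1 : q * t / (a + t) + p * a / (a + t) ^ 2
      = ((a + t) * q * t + p * a) / (a + t) ^ 2 := by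
    field_simp
  have e2 : ∀ k, k * (p / (a + t)) = (k * p * t + k * p * a) / (a + t) ^ 2 := by
    intro k; field_simp; ring
  rw [e1, e2, e2]
  have hpa : 0 ≤ p * a := by positivity
  constructor
  · apply div_le_div_of_nonneg_right _ (by positivity)
    nlinarith [mul_le_mul_of_nonneg_right hl ht.le, mul_le_mul_of_nonneg_right hGi hpa]
  · apply div_le_div_of_nonneg_right _ (by positivity)
    nlinarith [mul_le_mul_of_nonneg_right hu ht.le, mul_le_mul_of_nonneg_right hG hpa]

/-- Lemma 6 (first part): each shifted function `φ_a` is an N-function, is twice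
differentiable on `(0,∞)` with `φ_a''(t) ∼ φ'(a+t)/(a+t) ∼ φ''(a+t)`, and has the
good `φ_a'` property, all uniformly in the shift `a ≥ 0`. -/
theorem shifted_nfunction_good :
    ∃ c C Ga : ℝ → ℝ, ∀ (G : ℝ) (φ φ' φ'' : ℝ → ℝ),
      IsNFunction φ φ' → GoodPhi φ φ' φ'' G →
      0 < c G ∧ 0 < C G ∧
      ∀ a, 0 ≤ a →
        IsNFunction (shPhi φ' a) (shPhi' φ' a) ∧
        ∃ ψ'' : ℝ → ℝ,
          GoodPhi (shPhi φ' a) (shPhi' φ' a) ψ'' (Ga G) ∧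
          ∀ t, 0 < t →
            (c G * (φ' (a + t) / (a + t)) ≤ ψ'' t ∧
              ψ'' t ≤ C G * (φ' (a + t) / (a + t))) ∧
            (c G * φ'' (a + t) ≤ ψ'' t ∧ ψ'' t ≤ C G * φ'' (a + t)) := by
  refine ⟨fun G => G⁻¹ * G⁻¹, fun G => G * G, fun G => G, ?_⟩
  intro G φ φ' φ'' h1 h2
  have hG : 1 ≤ G := h2.1
  have hG0 : 0 < G := by linarith
  have hGi : G⁻¹ ≤ 1 := inv_le_one_of_one_le₀ hG
  have hGi0 : 0 < G⁻¹ := inv_pos.2 hG0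
  refine ⟨by positivity, by positivity, ?_⟩
  intro a ha
  have hN := sh_isN h1 h2 ha
  have hcont := sh_contOn h1 h2 ha
  have hpos := h1.2.2.2.2.1
  obtain ⟨_, _, hd, _, hc2, hb⟩ := id h2
  have hB := fun (t : ℝ) (ht : 0 < t) =>
    sh_bounds hG ha ht (hpos (a + t) (by linarith)) (hb (a + t) (by linarith)).1
      (hb (a + t) (by linarith)).2
  refine ⟨hN, fun t => φ'' (a + t) * t / (a + t) + φ' (a + t) * a / (a + t) ^ 2,
    ⟨hG, ?_, fun t ht => sh_hasDerivAt h2 ha ht, sh_cwa_zero h1 h2 ha, ?_, ?_⟩, ?_⟩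
  · intro t ht
    have hcI : ContinuousOn (shPhi' φ' a) (Ioi 0) := hcont.mono Ioi_subset_Ici_self
    exact intervalIntegral.integral_hasDerivAt_right
      ((hcont.mono (by rw [uIcc_of_le ht.le]; exact Icc_subset_Ici_self)).intervalIntegrable)
      (hcI.stronglyMeasurableAtFilter isOpen_Ioi t ht)
      (sh_hasDerivAt h2 ha ht).continuousAt
  · intro t ht
    have hut : 0 < a + t := by linarith
    have h3 : ContinuousAt (fun s : ℝ => φ' (a + s)) t :=
      ContinuousAt.comp (f := fun s : ℝ => a + s) (g := φ') (hd _ hut).continuousAt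
        (by fun_prop)
    have h4 : ContinuousAt (fun s : ℝ => φ'' (a + s)) t :=
      ContinuousAt.comp (f := fun s : ℝ => a + s) (g := φ'') (hc2 _ hut) (by fun_prop)
    exact ((h4.mul continuousAt_id).div (by fun_prop) hut.ne').add
      ((h3.mul continuousAt_const).div (by fun_prop) (by positivity))
  · intro t ht
    obtain ⟨b1, b2⟩ := hB t ht
    have e : ∀ k, k * shPhi' φ' a t = t * (k * (φ' (a + t) / (a + t))) := by
      intro k; unfold shPhi'; ring
    rw [e, e]
    exact ⟨mul_le_mul_of_nonneg_left b1 ht.le, mul_le_mul_of_nonneg_left b2 ht.le⟩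
  · intro t ht
    obtain ⟨b1, b2⟩ := hB t ht
    have hut : 0 < a + t := by linarith
    obtain ⟨c1, c2⟩ := hb (a + t) hut
    have hp : 0 < φ' (a + t) / (a + t) := div_pos (hpos _ hut) hut
    have d1 : G⁻¹ * (φ' (a + t) / (a + t)) ≤ φ'' (a + t) := by
      rw [← mul_div_assoc, div_le_iff₀ hut]; linarith
    have d2 : φ'' (a + t) ≤ G * (φ' (a + t) / (a + t)) := by
      rw [← mul_div_assoc, le_div_iff₀ hut]; linarith
    have d1' : φ' (a + t) / (a + t) ≤ G * φ'' (a + t) := by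
      rwa [inv_mul_le_iff₀ hG0] at d1
    have d2' : G⁻¹ * φ'' (a + t) ≤ φ' (a + t) / (a + t) := by
      rwa [inv_mul_le_iff₀ hG0]
    refine ⟨⟨le_trans ?_ b1, b2.trans ?_⟩, ⟨le_trans ?_ b1, b2.trans ?_⟩⟩
    · apply mul_le_mul_of_nonneg_right _ hp.le
      nlinarith
    · apply mul_le_mul_of_nonneg_right _ hp.le
      nlinarith
    · simp only [mul_assoc]
      exact mul_le_mul_of_nonneg_left d2' hGi0.le
    · simp only [mul_assoc]
      exact mul_le_mul_of_nonneg_left d1' hG0.le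
end
end

section
/- Let φ be an N-function satisfying the Δ₂ condition with constant K and, for a ≥ 0, let φ_a be the shifted N-function φ_a(t) = ∫₀ᵗ φ'(a+s)·s/(a+s) ds. Then there is a numerical constant C (independent of φ, a, K) such that every φ_a, a ≥ 0, satisfies the Δ₂ condition with constant at most C·K (uniform Δ₂-inheritance part of Lemma 6). -/
open MeasureTheory Real Set Filter

noncomputable section

theorem aux_int {h : ℝ → ℝ} (hm : ∀ s t, 0 ≤ s → s ≤ t → h s ≤ h t) {p q : ℝ}
    (hp : 0 ≤ p) (hpq : p ≤ q) : IntervalIntegrable h volume p q := by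
  apply MonotoneOn.intervalIntegrable
  intro x hx y hy hxy
  rw [uIcc_of_le hpq] at hx
  exact hm x y (hp.trans hx.1) hxy

theorem aux_lower {h : ℝ → ℝ} (hm : ∀ s t, 0 ≤ s → s ≤ t → h s ≤ h t) {p q : ℝ}
    (hp : 0 ≤ p) (hpq : p ≤ q) : (q - p) * h p ≤ ∫ s in p..q, h s := by
  have := intervalIntegral.integral_mono_on (f := fun _ => h p) (g := h) hpq
    intervalIntegrable_const (aux_int hm hp hpq) (fun x hx => hm p x hp hx.1)
  simpa using this

theorem aux_upper {h : ℝ → ℝ} (hm : ∀ s t, 0 ≤ s → s ≤ t → h s ≤ h t) {p q : ℝ}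
    (hp : 0 ≤ p) (hpq : p ≤ q) : ∫ s in p..q, h s ≤ (q - p) * h q := by
  have := intervalIntegral.integral_mono_on (g := fun _ => h q) (f := h) hpq
    (aux_int hm hp hpq) intervalIntegrable_const (fun x hx => hm x q (hp.trans hx.1) hx.2)
  simpa using this

theorem aux_split {h : ℝ → ℝ} (hm : ∀ s t, 0 ≤ s → s ≤ t → h s ≤ h t) {p q : ℝ}
    (hp : 0 ≤ p) (hpq : p ≤ q) :
    (∫ s in (0:ℝ)..q, h s) = (∫ s in (0:ℝ)..p, h s) + ∫ s in p..q, h s :=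
  (intervalIntegral.integral_add_adjacent_intervals (aux_int hm le_rfl hp)
    (aux_int hm hp hpq)).symm

/-- Lemma 6 (Δ₂ part): there is a numerical constant `C` such that every shifted
function `φ_a`, `a ≥ 0`, satisfies Δ₂ with constant at most `C·K`. -/
theorem shifted_delta2_uniform :
    ∃ C : ℝ, 0 < C ∧ ∀ (K : ℝ) (φ φ' : ℝ → ℝ) (a : ℝ),
      IsNFunction φ φ' → Delta2 φ K → 0 ≤ a →
      Delta2 (shPhi φ' a) (C * K) := by
  refine ⟨40, by norm_num, ?_⟩
  rintro K φ φ' a ⟨hφ, h0, hm, hz, hpos, -, -⟩ hK ha t ht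
  rcases ht.eq_or_lt with rfl | ht
  · simp [shPhi]
  have hφ0 : ∀ s, 0 ≤ s → 0 ≤ φ s := by
    intro s hs
    have := aux_lower hm le_rfl hs
    rw [hφ s hs]; rw [hz] at this; linarith
  have hφd : ∀ p q, 0 ≤ p → p ≤ q → φ q = φ p + ∫ s in p..q, φ' s := by
    intro p q hp hpq
    rw [hφ q (hp.trans hpq), hφ p hp]; exact aux_split hm hp hpq
  have hlow : ∀ p q, 0 ≤ p → p ≤ q → (q - p) * φ' p ≤ φ q - φ p := by
    intro p q hp hpq
    have := aux_lower hm hp hpq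
    have := hφd p q hp hpq
    linarith
  have hup : ∀ p, 0 ≤ p → φ p ≤ p * φ' p := by
    intro p hp
    have := aux_upper hm le_rfl hp
    rw [hφ p hp]; linarith
  have hK0 : 0 ≤ K := by
    have h1 := hK 1 zero_le_one
    have h2 := hφ0 (2 * 1) (by norm_num)
    have h3 := hlow (1/2) 1 (by norm_num) (by norm_num)
    have h4 := hpos (1/2) (by norm_num)
    have h5 := hφ0 (1/2) (by norm_num)
    have h6 : 0 < φ 1 := by linarith
    by_contra hneg
    push Not at hneg
    nlinarith
  set h : ℝ → ℝ := fun s => φ' (a + s) * s / (a + s) with hh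
  have hhm : ∀ s t, 0 ≤ s → s ≤ t → h s ≤ h t := by
    intro s t hs hst
    have ht0 : 0 ≤ t := hs.trans hst
    simp only [hh]
    rcases hs.eq_or_lt with rfl | hs
    · have := h0 (a + t) (by linarith)
      simp only [mul_zero, zero_div]
      positivity
    · rw [mul_div_assoc, mul_div_assoc]
      apply mul_le_mul (hm _ _ (by linarith) (by linarith)) _ (by positivity)
        (h0 _ (by linarith))
      rw [div_le_div_iff₀ (by linarith) (by linarith)]
      nlinarith
  have hhz : h 0 = 0 := by simp [hh]
  change (∫ s in (0:ℝ)..(2*t), h s) ≤ 40 * K * ∫ s in (0:ℝ)..t, h s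
  have hhalf : (∫ s in (t/2)..t, h s) ≤ ∫ s in (0:ℝ)..t, h s := by
    have h1 := aux_split hhm (p := t/2) (q := t) (by linarith) (by linarith)
    have h2 := aux_lower hhm (p := 0) (q := t/2) le_rfl (by linarith)
    rw [hhz] at h2
    linarith
  have h40 : 0 ≤ 40 * K := by linarith
  refine le_trans ?_ (mul_le_mul_of_nonneg_left hhalf h40)
  have hsm : ∀ s t, 0 ≤ s → s ≤ t → φ' (a + s) ≤ φ' (a + t) :=
    fun s t hs hst => hm _ _ (by linarith) (by linarith)
  rcases le_total (2 * t) a with hta | hta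
  · -- small shift parameter
    have hu := aux_upper hhm (p := 0) (q := 2 * t) le_rfl (by linarith)
    have hl := aux_lower hhm (p := t/2) (q := t) (by linarith) (by linarith)
    have key : φ' (a + 2 * t) ≤ 5 / 2 * K * φ' (a + t / 2) := by
      have e1 := hlow (a + 2 * t) (2 * (a + t / 2)) (by linarith) (by linarith)
      have e2 := hK (a + t / 2) (by linarith)
      have e3 := mul_le_mul_of_nonneg_left (hup (a + t / 2) (by linarith)) hK0
      have e4 := hφ0 (a + 2 * t) (by linarith)
      have e5 := h0 (a + 2 * t) (by linarith)
      have e6 : 2 / 5 * (a + t / 2) * φ' (a + 2 * t)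
          ≤ (2 * (a + t / 2) - (a + 2 * t)) * φ' (a + 2 * t) :=
        mul_le_mul_of_nonneg_right (by linarith) e5
      have e7 : (a + t / 2) * φ' (a + 2 * t)
          ≤ (a + t / 2) * (5 / 2 * K * φ' (a + t / 2)) := by linarith
      exact le_of_mul_le_mul_left e7 (by linarith)
    have key2 : h (2 * t) ≤ 10 * K * h (t / 2) := by
      have f1 : 2 * t / (a + 2 * t) ≤ 4 * (t / 2 / (a + t / 2)) := by
        rw [← mul_div_assoc, div_le_div_iff₀ (by linarith) (by linarith)]
        nlinarith
      have f2 := h0 (a + t / 2) (by linarith)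
      have := mul_le_mul key f1 (by positivity) (by positivity)
      simp only [hh]
      rw [mul_div_assoc (φ' (a + 2 * t)), mul_div_assoc (φ' (a + t / 2))]
      linarith
    calc (∫ s in (0:ℝ)..(2*t), h s) ≤ 2 * t * h (2 * t) := by linarith
      _ ≤ 2 * t * (10 * K * h (t / 2)) := by gcongr
      _ = 40 * K * ((t - t / 2) * h (t / 2)) := by ring
      _ ≤ _ := mul_le_mul_of_nonneg_left hl h40
  · -- large argument
    have g1 : (∫ s in (0:ℝ)..(2*t), h s) ≤ φ (a + 2 * t) := by
      have := intervalIntegral.integral_mono_on (f := h) (g := fun s => φ' (a + s))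
        (a := 0) (b := 2 * t) (μ := volume) (by linarith) (aux_int hhm le_rfl (by linarith))
        (aux_int hsm le_rfl (by linarith)) (by
          intro x hx
          simp only [hh]
          rw [mul_div_assoc]
          exact mul_le_of_le_one_right (h0 _ (by linarith [hx.1]))
            (div_le_one_of_le₀ (by linarith) (by linarith [hx.1])))
      rw [intervalIntegral.integral_comp_add_left, add_zero] at this
      have := hφd a (a + 2 * t) ha (by linarith)
      have := hφ0 a ha
      linarith
    have g2 : φ (a + t) - φ (a + t / 2) ≤ 5 * ∫ s in (t/2)..t, h s := by
      have := intervalIntegral.integral_mono_on (g := fun s => 5 * h s)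
        (f := fun s => φ' (a + s))
        (a := t / 2) (b := t) (μ := volume) (by linarith)
        (aux_int hsm (by linarith) (by linarith))
        ((aux_int hhm (by linarith) (by linarith)).const_mul 5) (by
          intro x hx
          have hx0 : 0 < a + x := by linarith [hx.1]
          simp only [hh]
          rw [← mul_div_assoc, le_div_iff₀ hx0]
          have := h0 (a + x) hx0.le
          have := mul_le_mul_of_nonneg_left (show a + x ≤ 5 * x by linarith [hx.1]) this
          linarith)
      rw [intervalIntegral.integral_comp_add_left, intervalIntegral.integral_const_mul] at this
      have := hφd (a + t / 2) (a + t) (by linarith) (by linarith)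
      linarith
    have g3 : φ (a + t) ≤ 6 * (φ (a + t) - φ (a + t / 2)) := by
      have e1 := hlow (a + t / 2) (a + t) (by linarith) (by linarith)
      have e2 := hup (a + t / 2) (by linarith)
      have e3 := h0 (a + t / 2) (by linarith)
      have e4 := mul_le_mul_of_nonneg_right (show a + t / 2 ≤ 5 * (t / 2) by linarith) e3
      linarith
    have g4 : φ (a + 2 * t) ≤ K * φ (a + t) := by
      have e1 := hlow (a + 2 * t) (2 * (a + t)) (by linarith) (by linarith)
      have e2 := hK (a + t) (by linarith)
      have e3 := h0 (a + 2 * t) (by linarith)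
      have e4 : 0 ≤ (2 * (a + t) - (a + 2 * t)) * φ' (a + 2 * t) :=
        mul_nonneg (by linarith) e3
      linarith
    have g5 : φ (a + t) ≤ 40 * ∫ s in (t/2)..t, h s := by
      have := hφ0 (a + t) (by linarith)
      linarith
    have := mul_le_mul_of_nonneg_left g5 hK0
    linarith
end
end

section
/- Let φ be an N-function with the good φ' property with constant G. Then there exists a constant C depending only on G such that for all real symmetric d×d matrices S, T, C₀ one has the change-of-shift estimate: φ'_{|S|}(|S − T|) ≤ C·( φ'_{|C₀|}(|S − C₀|) + φ'_{|C₀|}(|T − C₀|) ) (inequality (54) of Lemma 6). -/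
open MeasureTheory Real Set Filter

noncomputable section

attribute [local instance] Matrix.frobeniusNormedAddCommGroup in
theorem fnorm_sub_le_aux {d : ℕ} (A B : Matrix (Fin d) (Fin d) ℝ) :
    fnorm (A + B) ≤ fnorm A + fnorm B := by
  have key : ∀ P : Matrix (Fin d) (Fin d) ℝ, fnorm P = ‖P‖ := by
    intro P
    rw [Matrix.frobenius_norm_def, fnorm, minner, Real.sqrt_eq_rpow]
    congr 1
    refine Finset.sum_congr rfl fun i _ => Finset.sum_congr rfl fun j _ => ?_
    rw [Real.rpow_two, Real.norm_eq_abs, sq_abs, sq]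
  rw [key, key, key]
  exact norm_add_le A B

theorem fnorm_nonneg_aux {d : ℕ} (A : Matrix (Fin d) (Fin d) ℝ) : 0 ≤ fnorm A :=
  Real.sqrt_nonneg _

theorem fnorm_neg_aux {d : ℕ} (A : Matrix (Fin d) (Fin d) ℝ) : fnorm (-A) = fnorm A := by
  simp [fnorm, minner]

theorem tripling_aux {φ φ' φ'' : ℝ → ℝ} {G : ℝ} (hG : GoodPhi φ φ' φ'' G) {t : ℝ}
    (ht : 0 < t) : φ' (3 * t) ≤ (3 : ℝ) ^ G * φ' t := by
  obtain ⟨_, _, hd, _, _, hb⟩ := hG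
  have hder : ∀ u : ℝ, 0 < u → HasDerivAt (fun u => φ' u * u ^ (-G))
      (φ'' u * u ^ (-G) + φ' u * (-G * u ^ (-G - 1))) u := fun u hu =>
    (hd u hu).mul (Real.hasDerivAt_rpow_const (Or.inl hu.ne'))
  have hanti : AntitoneOn (fun u => φ' u * u ^ (-G)) (Set.Ioi 0) := by
    apply antitoneOn_of_deriv_nonpos (convex_Ioi 0)
    · exact fun u hu => (hder u hu).continuousAt.continuousWithinAt
    · intro u hu
      rw [interior_Ioi] at hu
      exact (hder u hu).differentiableAt.differentiableWithinAt
    · intro u hu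
      rw [interior_Ioi] at hu
      have hu0 : 0 < u := hu
      rw [(hder u hu).deriv]
      have e : u ^ (-G) = u * u ^ (-G - 1) := by
        rw [Real.rpow_sub_one hu0.ne']
        field_simp
      have hp : 0 < u ^ (-G - 1) := Real.rpow_pos_of_pos hu0 _
      rw [e]
      nlinarith [(hb u hu0).2]
  have h3 : φ' (3 * t) * (3 * t) ^ (-G) ≤ φ' t * t ^ (-G) :=
    hanti (show (0:ℝ) < t from ht) (show (0:ℝ) < 3 * t by positivity) (by linarith)
  rw [Real.mul_rpow (by norm_num) ht.le, Real.rpow_neg (by norm_num : (0:ℝ) ≤ 3)] at h3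
  have hp : 0 < t ^ (-G) := Real.rpow_pos_of_pos ht _
  have h3p : (0:ℝ) < 3 ^ G := Real.rpow_pos_of_pos (by norm_num) _
  have h4 : φ' (3 * t) * ((3:ℝ) ^ G)⁻¹ ≤ φ' t := by
    refine le_of_mul_le_mul_right ?_ hp
    linarith
  rw [← div_eq_mul_inv, div_le_iff₀ h3p] at h4
  linarith

theorem scalar_aux {φ φ' φ'' : ℝ → ℝ} {G : ℝ} (hN : IsNFunction φ φ')
    (hG : GoodPhi φ φ' φ'' G) {s c z M : ℝ} (hs : 0 ≤ s) (hc : 0 ≤ c) (hz : 0 ≤ z)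
    (hM : 0 ≤ M) (hzM : z ≤ 2 * M) (hsc : s ≤ c + M) (hcs : c ≤ s + M) :
    shPhi' φ' s z ≤ 2 * (3 : ℝ) ^ G * shPhi' φ' c M := by
  obtain ⟨_, hnn, hmono, _, _, _, _⟩ := hN
  have h3p : (0:ℝ) < 3 ^ G := Real.rpow_pos_of_pos (by norm_num) _
  unfold shPhi'
  have hcM0 := hnn (c + M) (by positivity)
  have hr : 0 ≤ 2 * (3 : ℝ) ^ G * (φ' (c + M) * M / (c + M)) := by positivity
  rcases eq_or_lt_of_le hz with h0 | hz0
  · simpa [← h0] using hr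
  have hMp : 0 < M := by linarith
  have h1 : φ' (s + z) ≤ (3:ℝ) ^ G * φ' (c + M) :=
    (hmono _ _ (by positivity) (by linarith)).trans (tripling_aux hG (by positivity))
  have h2 : z / (s + z) ≤ 2 * M / (c + M) := by
    rw [div_le_div_iff₀ (by positivity) (by positivity)]
    nlinarith
  calc φ' (s + z) * z / (s + z) = φ' (s + z) * (z / (s + z)) := by ring
    _ ≤ ((3:ℝ) ^ G * φ' (c + M)) * (2 * M / (c + M)) :=
        mul_le_mul h1 h2 (by positivity) (by positivity)
    _ = _ := by ring

/-- Change of shift (54): `φ'_{|S|}(|S−T|) ≤ C·(φ'_{|C₀|}(|S−C₀|) + φ'_{|C₀|}(|T−C₀|))`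
with `C` depending only on `G`. -/
theorem change_of_shift :
    ∃ C : ℝ → ℝ, ∀ (G : ℝ) (d : ℕ) (φ φ' φ'' : ℝ → ℝ),
      IsNFunction φ φ' → GoodPhi φ φ' φ'' G →
      ∀ S T C₀ : Matrix (Fin d) (Fin d) ℝ, S.IsSymm → T.IsSymm → C₀.IsSymm →
        shPhi' φ' (fnorm S) (fnorm (S - T)) ≤
          C G * (shPhi' φ' (fnorm C₀) (fnorm (S - C₀)) +
            shPhi' φ' (fnorm C₀) (fnorm (T - C₀))) := by
  refine ⟨fun G => 2 * (3 : ℝ) ^ G, ?_⟩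
  intro G d φ φ' φ'' hN hG S T C₀ _ _ _
  have h3p : (0:ℝ) < 3 ^ G := Real.rpow_pos_of_pos (by norm_num) _
  have hnn : ∀ t, 0 ≤ t → 0 ≤ shPhi' φ' (fnorm C₀) t := by
    intro t ht
    have hc := fnorm_nonneg_aux C₀
    have := hN.2.1 (fnorm C₀ + t) (by positivity)
    unfold shPhi'
    positivity
  have hx := fnorm_nonneg_aux (S - C₀)
  have hy := fnorm_nonneg_aux (T - C₀)
  have t1 : fnorm (S - T) ≤ fnorm (S - C₀) + fnorm (T - C₀) := by
    have := fnorm_sub_le_aux (S - C₀) (-(T - C₀))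
    rw [fnorm_neg_aux] at this
    convert this using 2
    abel
  have t2 : fnorm S ≤ fnorm C₀ + fnorm (S - C₀) := by
    have := fnorm_sub_le_aux C₀ (S - C₀)
    convert this using 2
    abel
  have t3 : fnorm C₀ ≤ fnorm S + fnorm (S - C₀) := by
    have := fnorm_sub_le_aux S (-(S - C₀))
    rw [fnorm_neg_aux] at this
    convert this using 2
    abel
  have hX := mul_nonneg (mul_pos two_pos h3p).le (hnn _ hx)
  have hY := mul_nonneg (mul_pos two_pos h3p).le (hnn _ hy)
  show _ ≤ 2 * (3 : ℝ) ^ G * _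
  rw [mul_add]
  rcases le_total (fnorm (S - C₀)) (fnorm (T - C₀)) with h | h
  · have := scalar_aux hN hG (fnorm_nonneg_aux S) (fnorm_nonneg_aux C₀)
      (fnorm_nonneg_aux (S - T)) hy (by linarith) (by linarith) (by linarith)
    linarith
  · have := scalar_aux hN hG (fnorm_nonneg_aux S) (fnorm_nonneg_aux C₀)
      (fnorm_nonneg_aux (S - T)) hx (by linarith) (by linarith) (by linarith)
    linarith
end
end

section
/- Let φ be an N-function with the good φ' property with constant G. Then there exists a constant C depending only on G such that for every a ≥ 0 and every λ ∈ [0,1]: φ_a(λ·a) ≤ C·λ²·φ(a) (inequality (55) of Lemma 6). -/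
open MeasureTheory Real Set Filter

noncomputable section

/-- `t ↦ φ'(t) t^{-G}` is non-increasing, hence `φ'(4b) ≤ 4^G φ'(b)`. -/
theorem good_growth (φ φ' φ'' : ℝ → ℝ) (G : ℝ) (h : GoodPhi φ φ' φ'' G) (b : ℝ) (hb : 0 < b) :
    φ' (4 * b) ≤ 4 ^ G * φ' b := by
  obtain ⟨hG, -, h2, -, -, h5⟩ := h
  have hd : ∀ t : ℝ, 0 < t → HasDerivAt (fun t => φ' t * t ^ (-G))
      (φ'' t * t ^ (-G) + φ' t * (-G * t ^ (-G - 1))) t := fun t ht =>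
    (h2 t ht).mul (Real.hasDerivAt_rpow_const (Or.inl ht.ne'))
  have hanti : AntitoneOn (fun t => φ' t * t ^ (-G)) (Ioi 0) := by
    apply antitoneOn_of_deriv_nonpos (convex_Ioi 0)
    · exact fun t ht => (hd t ht).continuousAt.continuousWithinAt
    · rw [interior_Ioi]
      exact fun t ht => (hd t ht).differentiableAt.differentiableWithinAt
    · rw [interior_Ioi]
      intro t ht
      have ht0 : 0 < t := ht
      rw [(hd t ht).deriv]
      have e : t ^ (-G) = t * t ^ (-G - 1) := by
        rw [Real.rpow_sub_one ht0.ne']; field_simp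
      have hp : 0 < t ^ (-G - 1) := Real.rpow_pos_of_pos ht0 _
      rw [e]
      nlinarith [(h5 t ht0).2]
  have h4 : 0 < 4 * b := by linarith
  have := hanti (mem_Ioi.2 hb) (mem_Ioi.2 h4) (by linarith)
  simp only at this
  rw [Real.rpow_neg h4.le, Real.rpow_neg hb.le, Real.mul_rpow (by norm_num) hb.le] at this
  have hbp : 0 < b ^ G := Real.rpow_pos_of_pos hb _
  have h4p : (0:ℝ) < 4 ^ G := Real.rpow_pos_of_pos (by norm_num) _
  rw [← div_eq_mul_inv, ← div_eq_mul_inv, div_le_div_iff₀ (by positivity) hbp] at this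
  have : b ^ G * φ' (4 * b) ≤ b ^ G * (4 ^ G * φ' b) := by linarith
  exact le_of_mul_le_mul_left this hbp

/-- Inequality (55): `φ_a(λ·a) ≤ C·λ²·φ(a)` for `a ≥ 0`, `λ ∈ [0,1]`, with `C`
depending only on `G`. -/
theorem shifted_quadratic_bound :
    ∃ C : ℝ → ℝ, ∀ (G : ℝ) (φ φ' φ'' : ℝ → ℝ),
      IsNFunction φ φ' → GoodPhi φ φ' φ'' G →
      ∀ a l : ℝ, 0 ≤ a → 0 ≤ l → l ≤ 1 →
        shPhi φ' a (l * a) ≤ C G * l ^ 2 * φ a := by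
  refine ⟨fun G => 4 ^ G, ?_⟩
  intro G φ φ' φ'' hN hgood a l ha hl hl1
  have hgr := good_growth φ φ' φ'' G hgood
  obtain ⟨hφ, hnn, hmono, h0, -, -, -⟩ := hN
  rcases ha.eq_or_lt with rfl | ha
  · rw [hφ 0 le_rfl]; simp [shPhi]
  have hla : 0 ≤ l * a := by positivity
  have hlaa : l * a ≤ a := by nlinarith
  have hint : ∀ x y : ℝ, 0 ≤ x → x ≤ y → IntervalIntegrable φ' volume x y := by
    intro x y hx hxy
    apply MonotoneOn.intervalIntegrable
    rw [uIcc_of_le hxy]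
    exact fun u hu v _ huv => hmono u v (hx.trans hu.1) huv
  have hup : shPhi φ' a (l * a) ≤ ∫ s in (0:ℝ)..(l * a), (φ' (2 * a) / a) * s := by
    unfold shPhi
    apply intervalIntegral.integral_mono_on hla
    · have hi : IntervalIntegrable (fun s => φ' (a + s)) volume 0 (l * a) := by
        apply MonotoneOn.intervalIntegrable
        rw [uIcc_of_le hla]
        exact fun u hu v _ huv => hmono _ _ (by linarith [hu.1]) (by linarith)
      have hc : ContinuousOn (fun s : ℝ => s / (a + s)) (uIcc 0 (l * a)) := by
        rw [uIcc_of_le hla]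
        apply ContinuousOn.div (by fun_prop) (by fun_prop)
        intro s hs
        have := hs.1
        positivity
      simpa only [mul_div_assoc] using hi.mul_continuousOn hc
    · exact (continuous_const.mul continuous_id).intervalIntegrable _ _
    · intro s hs
      have hs0 := hs.1
      have h1 : φ' (a + s) ≤ φ' (2 * a) := hmono _ _ (by linarith) (by linarith [hs.2])
      have h2 := hnn (2 * a) (by linarith)
      rw [div_mul_eq_mul_div]
      apply div_le_div₀ (by positivity) (by gcongr) ha (by linarith)
  have hval : (∫ s in (0:ℝ)..(l * a), (φ' (2 * a) / a) * s) = φ' (2 * a) * a / 2 * l ^ 2 := by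
    rw [intervalIntegral.integral_const_mul, integral_id]
    field_simp
    ring
  have hlow : a / 2 * φ' (a / 2) ≤ φ a := by
    rw [hφ a ha.le, ← intervalIntegral.integral_add_adjacent_intervals
      (hint 0 (a / 2) le_rfl (by linarith)) (hint (a / 2) a (by linarith) (by linarith))]
    have i1 : 0 ≤ ∫ s in (0:ℝ)..(a / 2), φ' s :=
      intervalIntegral.integral_nonneg (by linarith) fun s hs => hnn s hs.1
    have i2 : (∫ s in (a / 2)..a, φ' (a / 2)) ≤ ∫ s in (a / 2)..a, φ' s :=
      intervalIntegral.integral_mono_on (by linarith) (by simp)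
        (hint (a / 2) a (by linarith) (by linarith))
        fun s hs => hmono _ _ (by linarith) hs.1
    rw [intervalIntegral.integral_const, smul_eq_mul] at i2
    linarith
  have hg := hgr (a / 2) (by linarith)
  rw [show 4 * (a / 2) = 2 * a by ring] at hg
  have h4p : (0:ℝ) < 4 ^ G := Real.rpow_pos_of_pos (by norm_num) _
  have key : φ' (2 * a) * a / 2 ≤ 4 ^ G * φ a := by
    calc φ' (2 * a) * a / 2 ≤ (4 ^ G * φ' (a / 2)) * a / 2 := by gcongr
      _ = 4 ^ G * (a / 2 * φ' (a / 2)) := by ring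
      _ ≤ _ := by gcongr
  calc shPhi φ' a (l * a) ≤ φ' (2 * a) * a / 2 * l ^ 2 := hval ▸ hup
    _ ≤ 4 ^ G * φ a * l ^ 2 := by gcongr
    _ = _ := by ring
end
end

section
/- Let φ be an N-function with the good φ' property with constant G whose second derivative φ'' is almost increasing on (0,∞) with constant C₀ (i.e. φ''(s) ≤ C₀·φ''(t) whenever 0 < s ≤ t). Then there exists a constant C depending only on G and C₀ such that for all 0 ≤ a ≤ b and all t ≥ 0: φ_a(t) ≤ C·φ_b(t) (Proposition 4). -/
open MeasureTheory Real Set Filter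

noncomputable section

theorem shPhi_integrand_intervalIntegrable (φ φ' : ℝ → ℝ) (h : IsNFunction φ φ') (a t : ℝ)
    (ha : 0 ≤ a) (ht : 0 ≤ t) :
    IntervalIntegrable (fun s => φ' (a + s) * s / (a + s)) volume 0 t := by
  obtain ⟨-, h0, hm, -, -, -, -⟩ := h
  apply MonotoneOn.intervalIntegrable
  rw [Set.uIcc_of_le ht]
  intro x hx y hy hxy
  have hx0 := hx.1
  have hy0 := hy.1
  simp only [mul_div_assoc]
  have h1 : x / (a + x) ≤ y / (a + y) := by
    rcases hx0.eq_or_lt with h | h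
    · rw [← h]; simp; positivity
    · rw [div_le_div_iff₀ (by linarith) (by linarith)]
      nlinarith
  exact mul_le_mul (hm _ _ (by linarith) (by linarith)) h1 (by positivity) (h0 _ (by linarith))

/-- Proposition 4: if `φ''` is almost increasing with constant `C₀`, then
`a ≤ b` implies `φ_a(t) ≤ C·φ_b(t)` with `C` depending only on `G` and `C₀`. -/
theorem shifted_monotone_in_shift :
    ∃ C : ℝ → ℝ → ℝ, ∀ (G C₀ : ℝ) (φ φ' φ'' : ℝ → ℝ),
      IsNFunction φ φ' → GoodPhi φ φ' φ'' G →
      (∀ s t, 0 < s → s ≤ t → φ'' s ≤ C₀ * φ'' t) →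
      ∀ a b t, 0 ≤ a → a ≤ b → 0 ≤ t →
        shPhi φ' a t ≤ C G C₀ * shPhi φ' b t := by
  refine ⟨fun G C₀ => G * C₀ * G, ?_⟩
  intro G C₀ φ φ' φ'' hN hG hC a b t ha hab ht
  have hb : 0 ≤ b := ha.trans hab
  unfold shPhi
  rw [← intervalIntegral.integral_const_mul]
  apply intervalIntegral.integral_mono_on ht
    (shPhi_integrand_intervalIntegrable φ φ' hN a t ha ht)
    ((shPhi_integrand_intervalIntegrable φ φ' hN b t hb ht).const_mul _)
  intro s hs
  rcases hs.1.eq_or_lt with h | h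
  · simp [← h]
  obtain ⟨hG1, -, -, -, -, hg⟩ := hG
  have hG0 : 0 < G := by linarith
  have hx : 0 < a + s := by linarith
  have hy : 0 < b + s := by linarith
  have hp : 0 < φ' (a + s) := hN.2.2.2.2.1 _ hx
  have hp2 : 0 < φ' (b + s) := hN.2.2.2.2.1 _ hy
  have hc := hC (a + s) (b + s) hx (by linarith)
  have h1 : φ' (a + s) / (a + s) ≤ G * φ'' (a + s) := by
    rw [div_le_iff₀ hx]
    have := (hg _ hx).1
    rw [inv_mul_le_iff₀ hG0] at this
    linarith
  have h2 : φ'' (b + s) ≤ G * (φ' (b + s) / (b + s)) := by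
    rw [← mul_div_assoc, le_div_iff₀ hy]
    have := (hg _ hy).2
    linarith
  have h1' : 0 < φ'' (a + s) := by
    have : 0 < φ' (a + s) / (a + s) := by positivity
    exact pos_of_mul_pos_right (this.trans_le h1) hG0.le
  have h2' : 0 < φ'' (b + s) := by
    have h3 : 0 < G⁻¹ * φ' (b + s) := by positivity
    exact pos_of_mul_pos_right (h3.trans_le (hg _ hy).1) hy.le
  have hC0 : 0 ≤ C₀ := (pos_of_mul_pos_left (h1'.trans_le hc) h2'.le).le
  have key : φ' (a + s) / (a + s) ≤ G * C₀ * G * (φ' (b + s) / (b + s)) := by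
    calc φ' (a + s) / (a + s) ≤ G * φ'' (a + s) := h1
      _ ≤ G * (C₀ * φ'' (b + s)) := by gcongr
      _ ≤ G * (C₀ * (G * (φ' (b + s) / (b + s)))) := by gcongr
      _ = _ := by ring
  calc φ' (a + s) * s / (a + s) = φ' (a + s) / (a + s) * s := by ring
    _ ≤ G * C₀ * G * (φ' (b + s) / (b + s)) * s := by gcongr
    _ = _ := by ring
end
end
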